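/- Let r ∈ [1, ∞) and let (b_n)_{n=1}^∞ be a sequence of positive real numbers such that the sequence (n/b_n)_{n=1}^∞ is unbounded. For each n set E_n := {y ∈ 𝕀^n : |y| ≥ n − b_n}. Then sup over n ∈ {1,2,3,...} of the supremum, over nonzero f : 𝕀^n → ℂ whose Fourier transform vanishes on E_n, of the ratio ‖V_r(S_k f : k ∈ {0,1,...,n})‖_2 / ‖f‖_2 is infinite. -/

import Mathlib

open scoped ENNReal

/-- The spherical mean of radius `k` on the hypercube `{0,1}^n`. -/
noncomputable def sphMean (n k : ℕ) (f : (Fin n → Bool) → ℂ) (x : Fin n → Bool) : ℂ :=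
  ((n.choose k : ℂ))⁻¹ * ∑ y ∈ Finset.univ.filter (fun y => hammingDist x y = k), f y

/-- The `r`-variation seminorm of `a` over the index set `Z`, valued in `[0,∞]`. -/
noncomputable def eVar {ι : Type*} [LinearOrder ι] (r : ℝ) (a : ι → ℂ) (Z : Set ι) : ℝ≥0∞ :=
  ⨆ (J : ℕ) (t : Fin (J + 1) → ι) (_ : StrictMono t) (_ : ∀ j, t j ∈ Z),
    (∑ j : Fin J, (ENNReal.ofReal ‖a (t j.castSucc) - a (t j.succ)‖) ^ r) ^ r⁻¹

/-- The `ℓ²` norm of a `[0,∞]`-valued function on the hypercube. -/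
noncomputable def eL2 {n : ℕ} (V : (Fin n → Bool) → ℝ≥0∞) : ℝ≥0∞ :=
  (∑ x : Fin n → Bool, V x ^ (2 : ℝ)) ^ ((2 : ℝ))⁻¹

/-- The `ℓ²` norm of a complex function on the hypercube. -/
noncomputable def l2Norm {n : ℕ} (f : (Fin n → Bool) → ℂ) : ℝ :=
  Real.sqrt (∑ x : Fin n → Bool, ‖f x‖ ^ 2)

/-- The length (number of ones) of an element of the hypercube. -/
def wt {n : ℕ} (x : Fin n → Bool) : ℕ := (Finset.univ.filter (fun j => x j = true)).card

/-- The character `χ_y(x) = (-1)^{x·y}` on the hypercube. -/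
noncomputable def chi {n : ℕ} (y x : Fin n → Bool) : ℂ :=
  (-1) ^ ((Finset.univ.filter (fun j => x j = true ∧ y j = true)).card)

/-- The Fourier transform on the hypercube: `f̂(y) = 2^{-n/2} ∑_x f(x) χ_y(x)`. -/
noncomputable def fourierT {n : ℕ} (f : (Fin n → Bool) → ℂ) (y : Fin n → Bool) : ℂ :=
  ((Real.sqrt (2 ^ n) : ℂ))⁻¹ * ∑ x : Fin n → Bool, f x * chi y x


lemma count_mem (n k : ℕ) (hk : k ≤ n) (j : Fin n) :
    (n : ℝ) * (((Finset.powersetCard k (Finset.univ : Finset (Fin n))).filter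
      (fun D => j ∈ D)).card : ℝ) = k * (n.choose k : ℝ) := by
  obtain ⟨N, rfl⟩ : ∃ N, n = N + 1 := ⟨n - 1, by have := j.isLt; omega⟩
  have h1 := Finset.card_filter_add_card_filter_not
    (s := Finset.powersetCard k (Finset.univ : Finset (Fin (N + 1)))) (fun D => j ∈ D)
  have h2 : (Finset.powersetCard k (Finset.univ : Finset (Fin (N + 1)))).filter (fun D => ¬ j ∈ D)
      = Finset.powersetCard k (Finset.univ.erase j) := by
    ext D
    simp only [Finset.mem_filter, Finset.mem_powersetCard, Finset.subset_univ, true_and]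
    constructor
    · rintro ⟨h, h'⟩
      refine ⟨fun i hi => ?_, h⟩
      simp only [Finset.mem_erase, Finset.mem_univ, and_true]
      rintro rfl
      exact h' hi
    · rintro ⟨h, h'⟩
      refine ⟨h', fun hj => ?_⟩
      have := h hj
      simp at this
  rw [h2] at h1
  simp only [Finset.card_powersetCard, Finset.card_univ, Fintype.card_fin, Finset.mem_univ,
    Finset.card_erase_of_mem, Nat.add_sub_cancel] at h1
  have h3 := Nat.choose_mul_succ_eq N k
  have h1' : ((((Finset.powersetCard k (Finset.univ : Finset (Fin (N + 1)))).filter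
      (fun D => j ∈ D)).card : ℝ)) + (N.choose k : ℝ) = ((N + 1).choose k : ℝ) := by
    exact_mod_cast h1
  have h3' : (N.choose k : ℝ) * (N + 1) = ((N + 1).choose k : ℝ) * (N + 1 - k) := by
    have := congrArg (Nat.cast (R := ℝ)) h3
    push_cast [Nat.cast_sub hk] at this
    exact this
  push_cast
  linear_combination ((N : ℝ) + 1) * h1' - h3'

/-- The averages of `(-1)^{|D ∩ W|}`. -/
noncomputable def avgW {n : ℕ} (W : Finset (Fin n)) (k : ℕ) : ℝ :=
  (n.choose k : ℝ)⁻¹ * ∑ D ∈ Finset.powersetCard k (Finset.univ : Finset (Fin n)),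
    (-1 : ℝ) ^ (D ∩ W).card

lemma neg_one_pow_ge (j : ℕ) : 1 - 2 * (j : ℝ) ≤ (-1) ^ j := by
  rcases j with _ | j
  · simp
  · rcases neg_one_pow_eq_or ℝ (j + 1) with h | h <;> rw [h] <;> push_cast <;>
      linarith [(Nat.cast_nonneg j : (0 : ℝ) ≤ j)]

lemma avgW_ge {n : ℕ} (hn : 1 ≤ n) (W : Finset (Fin n)) (k : ℕ) (hk : k ≤ n)
    (h : 4 * k * W.card ≤ n) : 1 / 2 ≤ avgW W k := by
  have hc : (0 : ℝ) < (n.choose k : ℝ) := by exact_mod_cast Nat.choose_pos hk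
  have hn' : (0 : ℝ) < n := by exact_mod_cast hn
  set P := Finset.powersetCard k (Finset.univ : Finset (Fin n)) with hP
  have hPc : (P.card : ℝ) = n.choose k := by simp [hP]
  have hsum : ∑ D ∈ P, ((D ∩ W).card : ℝ)
      = ∑ j ∈ W, ((P.filter (fun D => j ∈ D)).card : ℝ) := by
    have : ∀ D ∈ P, ((D ∩ W).card : ℝ) = ∑ j ∈ W, if j ∈ D then (1 : ℝ) else 0 := by
      intro D _
      rw [Finset.sum_boole, Finset.inter_comm, Finset.filter_mem_eq_inter]
    rw [Finset.sum_congr rfl this, Finset.sum_comm]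
    simp [Finset.sum_boole]
  have hsum2 : (n : ℝ) * ∑ D ∈ P, ((D ∩ W).card : ℝ) = W.card * (k * n.choose k) := by
    rw [hsum, Finset.mul_sum, Finset.sum_congr rfl (fun j _ => count_mem n k hk j)]
    simp
  have hlow : (n.choose k : ℝ) - 2 * ∑ D ∈ P, ((D ∩ W).card : ℝ)
      ≤ ∑ D ∈ P, (-1 : ℝ) ^ (D ∩ W).card := by
    calc _ = ∑ D ∈ P, (1 - 2 * ((D ∩ W).card : ℝ)) := by
          rw [Finset.sum_sub_distrib, ← Finset.mul_sum]; simp [hPc]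
      _ ≤ _ := Finset.sum_le_sum fun D _ => neg_one_pow_ge _
  have h' : 4 * (k : ℝ) * W.card ≤ n := by exact_mod_cast h
  have h4 : 4 * ∑ D ∈ P, ((D ∩ W).card : ℝ) ≤ n.choose k := by
    have : (n : ℝ) * (4 * ∑ D ∈ P, ((D ∩ W).card : ℝ)) ≤ n * n.choose k := by
      calc _ = (4 * (k : ℝ) * W.card) * n.choose k := by linear_combination 4 * hsum2
        _ ≤ _ := by gcongr
    exact le_of_mul_le_mul_left this hn'
  unfold avgW
  rw [inv_mul_eq_div, le_div_iff₀ hc]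
  linarith

lemma chi_eq_prod {n : ℕ} (y x : Fin n → Bool) :
    chi y x = ∏ j, (if x j = true ∧ y j = true then (-1 : ℂ) else 1) := by
  unfold chi
  rw [Finset.prod_ite]
  simp

lemma chi_ne_zero {n : ℕ} (y x : Fin n → Bool) : chi y x ≠ 0 := by
  unfold chi; simp

lemma chi_norm {n : ℕ} (y x : Fin n → Bool) : ‖chi y x‖ = 1 := by
  unfold chi; simp

lemma fourier_chi {n : ℕ} (y y' : Fin n → Bool) (h : y ≠ y') : fourierT (chi y) y' = 0 := by
  unfold fourierT
  have : ∀ x : Fin n → Bool, chi y x * chi y' x = ∏ j, ((if x j = true ∧ y j = true then (-1 : ℂ) else 1)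
      * (if x j = true ∧ y' j = true then (-1 : ℂ) else 1)) := by
    intro x
    rw [chi_eq_prod, chi_eq_prod, Finset.prod_mul_distrib]
  simp only [this]
  rw [← Fintype.prod_sum (fun (j : Fin n) (b : Bool) =>
    ((if b = true ∧ y j = true then (-1 : ℂ) else 1)
      * (if b = true ∧ y' j = true then (-1 : ℂ) else 1)))]
  obtain ⟨j, hj⟩ := Function.ne_iff.mp h
  rw [Finset.prod_eq_zero (Finset.mem_univ j), mul_zero]
  cases h1 : y j <;> cases h2 : y' j <;> simp_all

lemma sph_chi {n : ℕ} (y : Fin n → Bool) (k : ℕ) (x : Fin n → Bool) :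
    sphMean n k (chi y) x = chi y x * (-1) ^ k *
      ((avgW (Finset.univ.filter (fun j => y j = false)) k : ℝ) : ℂ) := by
  unfold sphMean avgW
  push_cast
  rw [mul_left_comm]
  congr 1
  rw [Finset.mul_sum]
  refine Finset.sum_bij' (fun z _ => Finset.univ.filter (fun i => x i ≠ z i))
    (fun D _ => fun i => if i ∈ D then !(x i) else x i) ?_ ?_ ?_ ?_ ?_
  · intro z hz
    simpa [hammingDist, Finset.mem_powersetCard] using hz
  · intro D hD
    simp only [Finset.mem_powersetCard, Finset.subset_univ, true_and] at hD
    simp only [Finset.mem_filter, Finset.mem_univ, true_and, hammingDist]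
    rw [← hD]
    congr 1
    ext i
    by_cases h : i ∈ D <;> simp [h]
  · intro z hz
    funext i
    cases h1 : x i <;> cases h2 : z i <;> simp [h1, h2]
  · intro D hD
    ext i
    by_cases h : i ∈ D <;> simp [h]
  · intro z hz
    have hk : (Finset.univ.filter (fun i => x i ≠ z i)).card = k := by
      simpa [hammingDist] using hz
    rw [← hk, ← Finset.prod_const, ← Finset.prod_const, chi_eq_prod, chi_eq_prod,
      Finset.prod_filter, ← Finset.filter_and, Finset.prod_filter,
      ← Finset.prod_mul_distrib, ← Finset.prod_mul_distrib]
    refine Finset.prod_congr rfl fun i _ => ?_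
    cases h1 : x i <;> cases h2 : z i <;> cases h3 : y i <;> simp

lemma eVar_ge {n : ℕ} (r : ℝ) (hr : 1 ≤ r) (y x : Fin n → Bool) (J : ℕ) (hJn : J ≤ n)
    (ha : ∀ k ≤ J, 1 / 2 ≤ avgW (Finset.univ.filter (fun j => y j = false)) k) :
    (J : ℝ≥0∞) ^ r⁻¹ ≤ eVar r (fun k => sphMean n k (chi y) x) (Set.Iic n) := by
  unfold eVar
  refine le_iSup_of_le J <| le_iSup_of_le (fun i => i.val) <|
    le_iSup_of_le (fun a b h => h) <| le_iSup_of_le (fun j => ?_) ?_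
  · have := j.isLt
    simp only [Set.mem_Iic]
    omega
  · refine ENNReal.rpow_le_rpow ?_ (by positivity)
    calc (J : ℝ≥0∞) = ∑ j : Fin J, 1 := by simp
      _ ≤ _ := Finset.sum_le_sum fun j _ => ?_
    apply ENNReal.one_le_rpow _ (by linarith)
    rw [ENNReal.one_le_ofReal]
    simp only [sph_chi, Fin.val_castSucc, Fin.val_succ]
    have e : ∀ (c : ℂ) (a b : ℝ) (k : ℕ), c * (-1) ^ k * (a : ℂ) - c * (-1) ^ (k + 1) * (b : ℂ)
        = c * (-1) ^ k * ((a + b : ℝ) : ℂ) := by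
      intros; push_cast; ring
    rw [e, norm_mul, norm_mul, chi_norm, norm_pow, norm_neg, norm_one, one_pow, one_mul, one_mul,
      Complex.norm_real]
    have h1 := ha j (by omega)
    have h2 := ha (j + 1) (by omega)
    exact le_trans (by linarith) (Real.le_norm_self _)

lemma ratio_ge {n : ℕ} (r : ℝ) (hr : 1 ≤ r) (y : Fin n → Bool) (J : ℕ) (hJn : J ≤ n)
    (ha : ∀ k ≤ J, 1 / 2 ≤ avgW (Finset.univ.filter (fun j => y j = false)) k) :
    (J : ℝ≥0∞) ^ r⁻¹ ≤ eL2 (fun x => eVar r (fun k => sphMean n k (chi y) x) (Set.Iic n)) /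
          ENNReal.ofReal (l2Norm (chi y)) := by
  have hl : ENNReal.ofReal (l2Norm (chi y)) = ((2 : ℝ≥0∞) ^ n) ^ (2 : ℝ)⁻¹ := by
    unfold l2Norm
    simp only [chi_norm]
    rw [Real.sqrt_eq_rpow, ← ENNReal.ofReal_rpow_of_nonneg (by positivity) (by positivity)]
    simp
  rw [hl, ENNReal.le_div_iff_mul_le]
  · calc _ = (∑ x : Fin n → Bool, ((J : ℝ≥0∞) ^ r⁻¹) ^ (2 : ℝ)) ^ (2 : ℝ)⁻¹ := by
          simp only [Finset.sum_const, Finset.card_univ, Fintype.card_fun, Fintype.card_bool,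
            Fintype.card_fin, nsmul_eq_mul]
          rw [ENNReal.mul_rpow_of_nonneg _ _ (by positivity), ← ENNReal.rpow_mul _ 2,
            mul_inv_cancel₀ (by norm_num), ENNReal.rpow_one, mul_comm]
          push_cast
          rfl
      _ ≤ _ := by
          unfold eL2
          refine ENNReal.rpow_le_rpow (Finset.sum_le_sum fun x _ => ?_) (by positivity)
          exact ENNReal.rpow_le_rpow (eVar_ge r hr y x J hJn ha) (by positivity)
  · left
    simp
  · left
    simp

theorem statement4 (r : ℝ) (hr : 1 ≤ r) (b : ℕ → ℝ) (hb : ∀ n, 1 ≤ n → 0 < b n)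
    (hub : ∀ R : ℝ, ∃ n : ℕ, 1 ≤ n ∧ R < (n : ℝ) / b n) :
    (⨆ (n : ℕ) (_ : 1 ≤ n) (f : (Fin n → Bool) → ℂ) (_ : f ≠ 0)
        (_ : ∀ y : Fin n → Bool, (n : ℝ) - b n ≤ (wt y : ℝ) → fourierT f y = 0),
        eL2 (fun x => eVar r (fun k => sphMean n k f x) (Set.Iic n)) /
          ENNReal.ofReal (l2Norm f)) = ⊤ := by
  have hr0 : 0 < r := by linarith
  refine ENNReal.eq_top_of_forall_nnreal_le fun c => ?_
  obtain ⟨J, hJ1, hJc⟩ : ∃ J : ℕ, 1 ≤ J ∧ (c : ℝ≥0∞) ≤ (J : ℝ≥0∞) ^ r⁻¹ := by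
    obtain ⟨J, hJ⟩ := exists_nat_ge (c ^ r)
    refine ⟨J + 1, by omega, ?_⟩
    rw [ENNReal.le_rpow_inv_iff hr0, ← ENNReal.coe_rpow_of_nonneg _ hr0.le]
    have : c ^ r ≤ ((J + 1 : ℕ) : NNReal) := hJ.trans (by push_cast; simp)
    exact_mod_cast this
  obtain ⟨n, hn1, hn⟩ := hub (8 * J + ∑ i ∈ Finset.range (8 * J + 1), |(i : ℝ) / b i|)
  have hbn := hb n hn1
  have hs : 0 ≤ ∑ i ∈ Finset.range (8 * J + 1), |(i : ℝ) / b i| :=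
    Finset.sum_nonneg fun _ _ => abs_nonneg _
  have hnJ : 8 * J < n := by
    by_contra hcon
    have h1 := Finset.single_le_sum (f := fun i : ℕ => |(i : ℝ) / b i|)
      (fun i _ => abs_nonneg _) (Finset.mem_range.mpr (show n < 8 * J + 1 by omega))
    have h2 := le_abs_self ((n : ℝ) / b n)
    have h3 : (0 : ℝ) ≤ J := Nat.cast_nonneg J
    linarith
  set m := ⌊b n⌋₊ + 1 with hm
  have hmb : b n < m := by rw [hm]; push_cast; exact Nat.lt_floor_add_one _
  have hmb' : (m : ℝ) ≤ b n + 1 := by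
    rw [hm]; push_cast; linarith [Nat.floor_le hbn.le]
  have h8 : 8 * J * b n < n := by
    have : (8 * J : ℝ) < n / b n := by linarith
    rwa [lt_div_iff₀ hbn] at this
  have hJm : 4 * J * m ≤ n := by
    have h9 : (8 * J : ℝ) < n := by exact_mod_cast hnJ
    have : (4 * J * m : ℝ) ≤ n := by
      calc (4 * J * m : ℝ) ≤ 4 * J * (b n + 1) := by gcongr
        _ ≤ n := by linarith
    exact_mod_cast this
  have hmn : m ≤ n := by nlinarith
  set y : Fin n → Bool := fun i => decide (m ≤ i.val) with hy
  have hW : (Finset.univ.filter (fun j => y j = false)).card = m := by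
    simp only [hy, decide_eq_false_iff_not, not_le]
    rw [Fin.card_filter_val_lt]
    omega
  have hwt : wt y + m = n := by
    have := Finset.card_filter_add_card_filter_not (s := (Finset.univ : Finset (Fin n)))
      (fun j => y j = true)
    simp only [Bool.not_eq_true, hW] at this
    simpa [wt] using this
  refine hJc.trans ?_
  refine le_iSup_of_le n <| le_iSup_of_le hn1 <| le_iSup_of_le (chi y) <|
    le_iSup_of_le (fun h => chi_ne_zero y y (congrFun h y)) <|
    le_iSup_of_le (fun y' hy' => fourier_chi y y' ?_) ?_
  · rintro rfl
    have : (wt y : ℝ) + m = n := by exact_mod_cast hwt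
    linarith
  · refine ratio_ge r hr y J (by omega) fun k hk => avgW_ge hn1 _ k (by omega) ?_
    rw [hW]
    exact le_trans (by gcongr) hJm
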